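/- arXiv:2302.14798 — 4 statements merged into one kernel-verified Lean document; each statement's English description precedes it below -/
import Mathlib

section
/- For any |C|-dimensional teleportation protocol (ρ_{AB}, {Π^i}_{i=1}^N, {D^i}_{i=1}^N) with teleportation channel Λ, the entanglement fidelity satisfies F(Λ) = (1/|C|²) ∑_{i=1}^N tr(Π^i ω^i) = (N/|C|²)·p_succ, where ω^i = (id_A⊗D^i)(ρ_{AB}) and p_succ = (1/N) ∑_{i=1}^N tr(Π^i ω^i) is the success probability of the POVM {Π^i} discriminating the states ω^i drawn uniformly at random. -/
open Matrix BigOperators Finset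
open scoped Kronecker ComplexOrder

noncomputable section

/-- Partial trace over the second tensor factor. -/
def ptraceB {α β : Type*} [Fintype β] (M : Matrix (α × β) (α × β) ℂ) :
    Matrix α α ℂ :=
  Matrix.of fun a a' => ∑ b, M (a, b) (a', b)

/-- `ρ ↦ ∑ k (I ⊗ K k) ρ (I ⊗ K k)†`: a Kraus-operator channel `B → C` applied to the
second factor of a bipartite matrix on `A ⊗ B`. -/
def idKrausApply {a b c : ℕ} {m : ℕ} (K : Fin m → Matrix (Fin c) (Fin b) ℂ)
    (ρ : Matrix (Fin a × Fin b) (Fin a × Fin b) ℂ) :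
    Matrix (Fin a × Fin c) (Fin a × Fin c) ℂ :=
  ∑ k, ((1 : Matrix (Fin a) (Fin a) ℂ) ⊗ₖ K k) * ρ *
      ((1 : Matrix (Fin a) (Fin a) ℂ) ⊗ₖ K k)ᴴ

/-- The teleportation channel `Λ(σ) = ∑ i tr_{AC'}[(Πᵢ ⊗ I_C)(σ ⊗ ωᵢ)]`, written entrywise. -/
def teleChannel {a c N : ℕ}
    (Pv ω : Fin N → Matrix (Fin a × Fin c) (Fin a × Fin c) ℂ)
    (σ : Matrix (Fin c) (Fin c) ℂ) : Matrix (Fin c) (Fin c) ℂ :=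
  Matrix.of fun x y =>
    ∑ i, ∑ a₁ : Fin a, ∑ x₁ : Fin c, ∑ a₂ : Fin a, ∑ x₂ : Fin c,
      Pv i (a₁, x₁) (a₂, x₂) * σ x₂ x₁ * ω i (a₂, x) (a₁, y)

/-- The maximally entangled state `|Φ⁺⟩⟨Φ⁺|` with `|Φ⁺⟩ = c^{-1/2} ∑ᵢ |i⟩|i⟩`. -/
def maxEnt (c : ℕ) : Matrix (Fin c × Fin c) (Fin c × Fin c) ℂ :=
  Matrix.of fun p q => if p.1 = p.2 ∧ q.1 = q.2 then (1 : ℂ) / c else 0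

/-- `(id ⊗ Λ)(M)`, written entrywise (this is the correct formula for linear `Λ`). -/
def idOnFirst {c d : ℕ} (Λ : Matrix (Fin c) (Fin c) ℂ → Matrix (Fin c) (Fin c) ℂ)
    (M : Matrix (Fin d × Fin c) (Fin d × Fin c) ℂ) :
    Matrix (Fin d × Fin c) (Fin d × Fin c) ℂ :=
  Matrix.of fun p q => Λ (Matrix.of fun x y => M (p.1, x) (q.1, y)) p.2 q.2

/-- Entanglement fidelity `F(Λ) = tr[Φ⁺ (id ⊗ Λ)(Φ⁺)]` of the teleportation channel
determined by the POVM `Pv` and the encoded states `ω`. -/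
def entFid {a c N : ℕ}
    (Pv ω : Fin N → Matrix (Fin a × Fin c) (Fin a × Fin c) ℂ) : ℂ :=
  Matrix.trace (maxEnt c * idOnFirst (teleChannel Pv ω) (maxEnt c))

/-- Mutual information (base 2) of a joint probability distribution on a product of
finite sets; terms with `p x y = 0` vanish since `0 * log = 0`. -/
def mutInfo {X Y : Type*} [Fintype X] [Fintype Y] (p : X → Y → ℝ) : ℝ :=
  ∑ x, ∑ y, p x y * Real.logb 2 (p x y / ((∑ y', p x y') * (∑ x', p x' y)))

/-- Binary entropy (base 2). -/
def binEnt (p : ℝ) : ℝ := -(p * Real.logb 2 p) - (1 - p) * Real.logb 2 (1 - p)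

/-- The swap operator on `ℂ^d ⊗ ℂ^d`. -/
def swapOp (d : ℕ) : Matrix (Fin d × Fin d) (Fin d × Fin d) ℂ :=
  Matrix.of fun p q => if p.1 = q.2 ∧ p.2 = q.1 then 1 else 0

/-- The overlap with the maximally entangled state is the normalised sum over its support. -/
theorem trace_maxEnt_mul {c : ℕ} (X : Matrix (Fin c × Fin c) (Fin c × Fin c) ℂ) :
    Matrix.trace (maxEnt c * X) = (1 / (c : ℂ)) * ∑ s, ∑ t, X (t, t) (s, s) := by
  simp only [Matrix.trace, Matrix.diag_apply, Matrix.mul_apply, maxEnt, Matrix.of_apply,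
    Fintype.sum_prod_type, ite_and, ite_mul, zero_mul]
  simp [Finset.mul_sum, Finset.sum_ite_eq]

theorem idOnFirst_teleChannel_maxEnt_apply {a c N : ℕ}
    (Pv ω : Fin N → Matrix (Fin a × Fin c) (Fin a × Fin c) ℂ) (s t : Fin c) :
    idOnFirst (teleChannel Pv ω) (maxEnt c) (t, t) (s, s) =
      (1 / (c : ℂ)) * ∑ i, ∑ a₁, ∑ a₂, Pv i (a₁, s) (a₂, t) * ω i (a₂, t) (a₁, s) := by
  simp only [idOnFirst, teleChannel, maxEnt, Matrix.of_apply, ite_and, mul_ite, ite_mul,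
    mul_zero, zero_mul, Finset.mul_sum]
  refine Finset.sum_congr rfl fun i _ => Finset.sum_congr rfl fun a₁ _ => ?_
  rw [Finset.sum_comm]
  refine Finset.sum_congr rfl fun a₂ _ => ?_
  simp only [Finset.sum_ite_eq, Finset.mem_univ, if_true]
  ring

theorem entFid_eq_sum_trace {a c N : ℕ}
    (Pv ω : Fin N → Matrix (Fin a × Fin c) (Fin a × Fin c) ℂ) :
    entFid Pv ω = (1 / (c : ℂ) ^ 2) * ∑ i, Matrix.trace (Pv i * ω i) := by
  have h : ∑ s, ∑ t, ∑ i, ∑ a₁, ∑ a₂, Pv i (a₁, s) (a₂, t) * ω i (a₂, t) (a₁, s) =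
      ∑ i, Matrix.trace (Pv i * ω i) := by
    simp only [Matrix.trace, Matrix.diag_apply, Matrix.mul_apply, Fintype.sum_prod_type]
    calc
      _ = ∑ s, ∑ i, ∑ a₁, ∑ a₂, ∑ t, Pv i (a₁, s) (a₂, t) * ω i (a₂, t) (a₁, s) := by
        refine Finset.sum_congr rfl fun s _ => ?_
        rw [Finset.sum_comm]
        refine Finset.sum_congr rfl fun i _ => ?_
        rw [Finset.sum_comm]
        exact Finset.sum_congr rfl fun a₁ _ => Finset.sum_comm
      _ = _ := by
        rw [Finset.sum_comm]
        exact Finset.sum_congr rfl fun i _ => Finset.sum_comm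
  simp only [entFid, trace_maxEnt_mul, idOnFirst_teleChannel_maxEnt_apply, ← Finset.mul_sum, h]
  rw [← mul_assoc]
  congr 1
  ring

/-- the entanglement fidelity of a general teleportation protocol equals
`(1/|C|²) ∑ᵢ tr(Πᵢ ωᵢ) = (N/|C|²) p_succ`. -/
theorem stmt_0 {a b c N m : ℕ} (hc : 0 < c)
    (ρ : Matrix (Fin a × Fin b) (Fin a × Fin b) ℂ)
    (hρ : ρ.PosSemidef) (hρtr : ρ.trace = 1)
    (Pv : Fin N → Matrix (Fin a × Fin c) (Fin a × Fin c) ℂ)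
    (hPv : ∀ i, (Pv i).PosSemidef) (hPvsum : ∑ i, Pv i = 1)
    (K : Fin N → Fin m → Matrix (Fin c) (Fin b) ℂ)
    (hK : ∀ i, ∑ k, (K i k)ᴴ * K i k = 1) :
    entFid Pv (fun i => idKrausApply (K i) ρ) =
        (1 / (c : ℂ) ^ 2) * ∑ i, Matrix.trace (Pv i * idKrausApply (K i) ρ) ∧
      entFid Pv (fun i => idKrausApply (K i) ρ) =
        ((N : ℂ) / (c : ℂ) ^ 2) *
          ((1 / (N : ℂ)) * ∑ i, Matrix.trace (Pv i * idKrausApply (K i) ρ)) := by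
  refine ⟨entFid_eq_sum_trace _ _, ?_⟩
  rw [entFid_eq_sum_trace, ← mul_assoc]
  rcases Nat.eq_zero_or_pos N with rfl | hN
  · simp
  · have hN' : (N : ℂ) ≠ 0 := Nat.cast_ne_zero.mpr hN.ne'
    congr 1
    field_simp
end
end

section
/- Let (ρ_{AB}, {Π^i}_{i=1}^N, {D^i}_{i=1}^N) define an N-message dense coding protocol with classical channel W given by p(j|i) = tr(Π^j ω^i), where ω^i = (id_A⊗D^i)(ρ_{AB}). If every ω^i satisfies the reduction criterion ω^i ≤ ρ_A⊗I_C (with ρ_A = tr_B ρ_{AB}), then the classical correlation fidelity satisfies F_cl(W) = (1/N) ∑_{i=1}^N p(i|i) ≤ |C|/N. -/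
open Matrix BigOperators Finset
open scoped Kronecker ComplexOrder

noncomputable section

open scoped MatrixOrder Matrix.Norms.L2Operator in
/-- The trace of a product of two positive semidefinite complex matrices is nonnegative. -/
theorem trace_mul_nonneg_of_posSemidef {n : Type*} [Fintype n] [DecidableEq n]
    {A B : Matrix n n ℂ} (hA : A.PosSemidef) (hB : B.PosSemidef) : 0 ≤ (A * B).trace := by
  obtain ⟨C, rfl⟩ := CStarAlgebra.nonneg_iff_eq_star_mul_self.mp hA.nonneg
  rw [Matrix.mul_assoc, Matrix.trace_mul_comm]
  exact (hB.mul_mul_conjTranspose_same C).trace_nonneg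

theorem trace_ptraceB {α β : Type*} [Fintype α] [Fintype β] (M : Matrix (α × β) (α × β) ℂ) :
    (ptraceB M).trace = M.trace := by
  simp [ptraceB, Matrix.trace, Fintype.sum_prod_type]

/-- if every encoded state `ωᵢ = (id ⊗ Dᵢ)(ρ)` of a dense coding protocol
satisfies the reduction criterion `ωᵢ ≤ ρ_A ⊗ I_C`, then the classical correlation
fidelity `F_cl(W) = (1/N) ∑ᵢ p(i|i)` is at most `|C|/N`. -/
theorem stmt_13 {a b c N m : ℕ} (hN : 0 < N)
    (ρ : Matrix (Fin a × Fin b) (Fin a × Fin b) ℂ)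
    (hρ : ρ.PosSemidef) (hρtr : ρ.trace = 1)
    (Pv : Fin N → Matrix (Fin a × Fin c) (Fin a × Fin c) ℂ)
    (hPv : ∀ i, (Pv i).PosSemidef) (hPvsum : ∑ i, Pv i = 1)
    (K : Fin N → Fin m → Matrix (Fin c) (Fin b) ℂ)
    (hK : ∀ i, ∑ k, (K i k)ᴴ * K i k = 1)
    (hred : ∀ i,
      ((ptraceB ρ) ⊗ₖ (1 : Matrix (Fin c) (Fin c) ℂ) - idKrausApply (K i) ρ).PosSemidef) :
    (1 / (N : ℂ)) * ∑ i, Matrix.trace (Pv i * idKrausApply (K i) ρ) ≤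
      (c : ℂ) / (N : ℂ) := by
  have hle : ∑ i, (Pv i * idKrausApply (K i) ρ).trace ≤ (c : ℂ) := calc
    _ ≤ ∑ i, (Pv i * (ptraceB ρ ⊗ₖ (1 : Matrix (Fin c) (Fin c) ℂ))).trace := by
      refine Finset.sum_le_sum fun i _ => sub_nonneg.mp ?_
      rw [← Matrix.trace_sub, ← Matrix.mul_sub]
      exact trace_mul_nonneg_of_posSemidef (hPv i) (hred i)
    _ = c := by
      rw [← Matrix.trace_sum, ← Finset.sum_mul, hPvsum, one_mul, Matrix.trace_kronecker,
        trace_ptraceB, hρtr, Matrix.trace_one, Fintype.card_fin, one_mul]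
  rw [one_div, div_eq_inv_mul]
  exact mul_le_mul_of_nonneg_left hle (inv_nonneg.mpr (Nat.cast_nonneg N))
end
end

section
/- Let ω^1,…,ω^N be quantum states on a finite-dimensional space ℂ^D, and let p* = max over all N-outcome POVMs {M_i} of (1/N) ∑_{i=1}^N tr(M_i ω^i) be the optimal success probability of discriminating the ω^i drawn uniformly at random. Then for every POVM {M_y}_{y∈Y} with any finite outcome set Y, the mutual information I(X;Y) of the joint distribution p(x,y) = (1/N) tr(M_y ω^x) on {1,…,N}×Y satisfies I(X;Y) ≤ log₂ N + log₂ p*. -/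
open Matrix BigOperators Finset
open scoped Kronecker ComplexOrder

noncomputable section

open scoped MatrixOrder in
/-- The trace of a product of two positive semidefinite matrices is nonnegative. -/
theorem Matrix.PosSemidef.zero_le_re_trace_mul {n : Type*} [Fintype n] [DecidableEq n]
    {A B : Matrix n n ℂ} (hA : A.PosSemidef) (hB : B.PosSemidef) :
    0 ≤ (A * B).trace.re := by
  obtain ⟨C, rfl⟩ := CStarAlgebra.nonneg_iff_eq_star_mul_self.mp hA.nonneg
  rw [Matrix.star_eq_conjTranspose, Matrix.mul_assoc, Matrix.trace_mul_comm]
  exact (Complex.le_def.mp (hB.mul_mul_conjTranspose_same C).trace_nonneg).1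

/-- Pointwise estimate behind the bound of mutual information by the guessing probability:
`p` is a joint probability, `q` its second marginal, `m` the largest joint probability with the
same second coordinate, and `s` bounds the success probability. -/
theorem mul_logb_le_of_le_max {p q m s N : ℝ} (hp : 0 ≤ p) (hpq : p ≤ q) (hpm : p ≤ m)
    (hs : 0 < s) (hN : 0 < N) :
    p * Real.logb 2 (p / (1 / N * q)) ≤
      p * (Real.logb 2 N + Real.logb 2 s) + (m / s * (p / q) - p) / Real.log 2 := by
  rcases hp.eq_or_lt with rfl | hp
  · simp
  have hq : 0 < q := hp.trans_le hpq
  have hm : 0 < m := hp.trans_le hpm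
  have h2 : 0 < Real.log 2 := Real.log_pos one_lt_two
  have hle : Real.log (p / (1 / N * q)) ≤ Real.log N + Real.log s + (m / q / s - 1) := by
    have h1 : Real.log (p / (1 / N * q)) ≤ Real.log (N * (s * (m / q / s))) := by
      apply Real.log_le_log (by positivity)
      have : p / (1 / N * q) = N * (p / q) := by field_simp
      rw [this, mul_div_cancel₀ _ hs.ne']
      gcongr
    rw [Real.log_mul hN.ne' (by positivity), Real.log_mul hs.ne' (by positivity)] at h1
    linarith [Real.log_le_sub_one_of_pos (show 0 < m / q / s by positivity)]
  calc p * Real.logb 2 (p / (1 / N * q))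
      ≤ p * ((Real.log N + Real.log s + (m / q / s - 1)) / Real.log 2) := by
        unfold Real.logb; gcongr
    _ = _ := by unfold Real.logb; field_simp

/-- If the first marginal is uniform, mutual information is at most `log₂ N + log₂ s` whenever
`s` bounds the success probability of the maximum-likelihood guess `f`. -/
theorem mutInfo_le_of_guess {X Y : Type*} [Fintype X] [Nonempty X] [Fintype Y] (p : X → Y → ℝ)
    (hp : ∀ x y, 0 ≤ p x y) (hX : ∀ x, ∑ y, p x y = 1 / (Fintype.card X : ℝ))
    (f : Y → X) (hf : ∀ x y, p x y ≤ p (f y) y) (s : ℝ) (hs : ∑ y, p (f y) y ≤ s) :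
    mutInfo p ≤ Real.logb 2 (Fintype.card X) + Real.logb 2 s := by
  have hN : (0 : ℝ) < Fintype.card X := by exact_mod_cast Fintype.card_pos
  have h2 : 0 < Real.log 2 := Real.log_pos one_lt_two
  have hs0 : 0 < s := by
    obtain ⟨x⟩ := ‹Nonempty X›
    have : ∑ y, p x y ≤ ∑ y, p (f y) y := Finset.sum_le_sum fun y _ => hf x y
    rw [hX] at this
    have : 0 < 1 / (Fintype.card X : ℝ) := by positivity
    linarith
  have htot : ∑ x, ∑ y, p x y = 1 := by
    simp [hX, hN.ne']
  have hcol : ∑ x, ∑ y, p (f y) y / s * (p x y / ∑ x', p x' y) ≤ 1 := by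
    rw [Finset.sum_comm]
    calc ∑ y, ∑ x, p (f y) y / s * (p x y / ∑ x', p x' y)
        ≤ ∑ y, p (f y) y / s := by
          refine Finset.sum_le_sum fun y _ => ?_
          rw [← Finset.mul_sum, ← Finset.sum_div]
          exact mul_le_of_le_one_right (div_nonneg (hp _ _) hs0.le) (div_self_le_one _)
      _ ≤ 1 := by
          rw [← Finset.sum_div]
          exact (div_le_one hs0).mpr hs
  calc mutInfo p
      ≤ ∑ x, ∑ y, (p x y * (Real.logb 2 (Fintype.card X) + Real.logb 2 s) +
          (p (f y) y / s * (p x y / ∑ x', p x' y) - p x y) / Real.log 2) := by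
        refine Finset.sum_le_sum fun x _ => Finset.sum_le_sum fun y _ => ?_
        rw [hX]
        exact mul_logb_le_of_le_max (hp x y)
          (Finset.single_le_sum (f := fun x' => p x' y) (fun x' _ => hp x' y) (Finset.mem_univ x))
          (hf x y) hs0 hN
    _ = Real.logb 2 (Fintype.card X) + Real.logb 2 s +
          (∑ x, ∑ y, p (f y) y / s * (p x y / ∑ x', p x' y) - 1) / Real.log 2 := by
        simp only [Finset.sum_add_distrib, ← Finset.sum_mul, ← Finset.sum_div,
          Finset.sum_sub_distrib, htot, one_mul]
    _ ≤ Real.logb 2 (Fintype.card X) + Real.logb 2 s := by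
        have := div_nonpos_of_nonpos_of_nonneg (sub_nonpos.mpr hcol) h2.le
        linarith

/-- Post-processing a measurement by a guess `f` of the state index gives the success sum
of the relabelled measurement. -/
theorem sum_trace_fiber_mul {n X Y : Type*} [Fintype n] [Fintype X] [DecidableEq X] [Fintype Y]
    (M : Y → Matrix n n ℂ) (ω : X → Matrix n n ℂ) (f : Y → X) :
    ∑ x, ((∑ y with f y = x, M y) * ω x).trace = ∑ y, (M y * ω (f y)).trace := by
  rw [← Finset.sum_fiberwise Finset.univ f fun y => (M y * ω (f y)).trace]
  refine Finset.sum_congr rfl fun x _ => ?_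
  rw [Finset.sum_mul, Matrix.trace_sum]
  refine Finset.sum_congr rfl fun y hy => ?_
  rw [(Finset.mem_filter.mp hy).2]

/-- for states `ω¹,…,ω^N` with optimal uniform-prior discrimination
success probability `p*` (a maximum over all `N`-outcome POVMs), every measurement
`{M_y}` yields mutual information `I(X;Y) ≤ log₂ N + log₂ p*` for the joint
distribution `p(x,y) = (1/N) tr(M_y ω^x)`. -/
theorem stmt_16 {D N : ℕ} (hN : 0 < N) (hD : 0 < D)
    (ω : Fin N → Matrix (Fin D) (Fin D) ℂ)
    (hω : ∀ i, (ω i).PosSemidef ∧ (ω i).trace = 1)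
    (pstar : ℝ)
    (hpstar : IsGreatest {p : ℝ |
        ∃ M : Fin N → Matrix (Fin D) (Fin D) ℂ,
          (∀ i, (M i).PosSemidef) ∧ (∑ i, M i = 1) ∧
            ((1 / (N : ℂ)) * ∑ i, Matrix.trace (M i * ω i)).re = p} pstar)
    {Y : Type*} [Fintype Y]
    (M : Y → Matrix (Fin D) (Fin D) ℂ)
    (hM : ∀ y, (M y).PosSemidef) (hMsum : ∑ y, M y = 1) :
    mutInfo (fun (x : Fin N) (y : Y) => ((1 / (N : ℂ)) * Matrix.trace (M y * ω x)).re) ≤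
      Real.logb 2 N + Real.logb 2 pstar := by
  have : Nonempty (Fin N) := ⟨⟨0, hN⟩⟩
  have hre : ∀ z : ℂ, (1 / (N : ℂ) * z).re = 1 / (N : ℝ) * z.re := fun z => by
    rw [← Complex.re_ofReal_mul]
    push_cast
    rfl
  choose f hf using fun y => Finite.exists_max fun x : Fin N => (1 / (N : ℂ) * (M y * ω x).trace).re
  have hguess : ∑ y, (1 / (N : ℂ) * (M y * ω (f y)).trace).re ≤ pstar := by
    refine hpstar.2 ⟨fun x => ∑ y with f y = x, M y,
      fun x => Matrix.posSemidef_sum _ fun y _ => hM y, ?_, ?_⟩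
    · rw [Finset.sum_fiberwise, hMsum]
    · rw [sum_trace_fiber_mul, Finset.mul_sum, Complex.re_sum]
  have hmain := mutInfo_le_of_guess
    (fun (x : Fin N) (y : Y) => (1 / (N : ℂ) * (M y * ω x).trace).re)
    (fun x y => by
      rw [hre]
      exact mul_nonneg (by positivity) ((hM y).zero_le_re_trace_mul (hω x).1))
    (fun x => by
      rw [← Complex.re_sum, ← Finset.mul_sum, ← Matrix.trace_sum, ← Finset.sum_mul, hMsum,
        Matrix.one_mul, (hω x).2, hre, Fintype.card_fin]
      simp)
    f (fun x y => hf y x) pstar hguess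
  rwa [Fintype.card_fin] at hmain
end
end

section
/- Let (ρ_{AB}, {D^i}_{i=1}^N) define the encoded states ω^i = (id_A⊗D^i)(ρ_{AB}) of an N-message dense coding protocol over a |C|-dimensional quantum channel, and suppose every ω^i satisfies the reduction criterion ω^i ≤ ρ_A⊗I_C (with ρ_A = tr_B ρ_{AB}). Then for every POVM {M_y}_{y∈Y} on ℂ^{|A|}⊗ℂ^{|C|} with any finite outcome set Y, the mutual information I(X;Y) of the joint distribution p(x,y) = (1/N) tr(M_y ω^x) satisfies I(X;Y) ≤ log₂ |C|. -/
open Matrix BigOperators Finset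
open scoped Kronecker ComplexOrder

noncomputable section

theorem mutInfo_le_logb_of_le_mul {X Y : Type*} [Fintype X] [Fintype Y] (p : X → Y → ℝ)
    (t : Y → ℝ) {d : ℝ} (hd : 0 < d) (hp : ∀ x y, 0 ≤ p x y) (hsum : ∑ x, ∑ y, p x y = 1)
    (ht : ∀ y, 0 ≤ t y) (htsum : ∑ y, t y = d)
    (hle : ∀ x y, p x y ≤ (∑ y', p x y') * t y) :
    mutInfo p ≤ Real.logb 2 d := by
  have h2 : 0 < Real.log 2 := Real.log_pos one_lt_two
  have key : ∀ x y, p x y * Real.log (p x y / ((∑ y', p x y') * (∑ x', p x' y))) ≤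
      p x y * Real.log d + (p x y * (t y / (d * ∑ x', p x' y)) - p x y) := by
    intro x y
    rcases (hp x y).eq_or_lt with h | h
    · simp [← h]
    · have hX : 0 < ∑ y', p x y' :=
        h.trans_le (Finset.single_le_sum (fun y' _ => hp x y') (Finset.mem_univ y))
      have hY : 0 < ∑ x', p x' y :=
        h.trans_le (Finset.single_le_sum (fun x' _ => hp x' y) (Finset.mem_univ x))
      have hty : 0 < t y := pos_of_mul_pos_right (h.trans_le (hle x y)) hX.le
      have h1 : p x y / ((∑ y', p x y') * (∑ x', p x' y)) ≤
          d * (t y / (d * ∑ x', p x' y)) := by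
        calc _ ≤ ((∑ y', p x y') * t y) / ((∑ y', p x y') * (∑ x', p x' y)) := by
              gcongr
              exact hle x y
          _ = _ := by field_simp
      have h3 := Real.log_le_log (by positivity) h1
      rw [Real.log_mul hd.ne' (by positivity)] at h3
      have h4 := Real.log_le_sub_one_of_pos (x := t y / (d * ∑ x', p x' y)) (by positivity)
      calc _ ≤ p x y * (Real.log d + (t y / (d * ∑ x', p x' y) - 1)) := by
            gcongr
            linarith
        _ = _ := by ring
  have hcol : ∀ y, ∑ x, p x y * (t y / (d * ∑ x', p x' y)) ≤ t y / d := by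
    intro y
    rw [← Finset.sum_mul]
    rcases eq_or_ne (∑ x, p x y) 0 with h | h
    · rw [h, zero_mul]
      exact div_nonneg (ht y) hd.le
    · apply le_of_eq
      field_simp
  have htot : ∑ x, ∑ y, p x y * (t y / (d * ∑ x', p x' y)) ≤ 1 := by
    rw [Finset.sum_comm]
    calc _ ≤ ∑ y, t y / d := Finset.sum_le_sum fun y _ => hcol y
      _ = 1 := by rw [← Finset.sum_div, htsum, div_self hd.ne']
  have hmain := Finset.sum_le_sum fun x (_ : x ∈ Finset.univ) =>
    Finset.sum_le_sum fun y (_ : y ∈ Finset.univ) => key x y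
  simp only [Finset.sum_add_distrib, Finset.sum_sub_distrib, ← Finset.sum_mul, hsum,
    one_mul] at hmain
  simp only [mutInfo, Real.logb, ← mul_div_assoc, ← Finset.sum_div]
  gcongr
  linarith

theorem Matrix.PosSemidef.re_trace_mul_nonneg {n : Type*} [Fintype n] {A B : Matrix n n ℂ}
    (hA : A.PosSemidef) (hB : B.PosSemidef) : 0 ≤ (A * B).trace.re := by
  classical
  obtain ⟨S, rfl⟩ : ∃ S : Matrix n n ℂ, A = Sᴴ * S := by
    open scoped MatrixOrder in
    exact CStarAlgebra.nonneg_iff_eq_star_mul_self.mp hA.nonneg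
  rw [Matrix.mul_assoc, Matrix.trace_mul_comm]
  exact (Complex.le_def.mp (hB.mul_mul_conjTranspose_same S).trace_nonneg).1

theorem idKrausApply_posSemidef {a b c m : ℕ} (K : Fin m → Matrix (Fin c) (Fin b) ℂ)
    {ρ : Matrix (Fin a × Fin b) (Fin a × Fin b) ℂ} (hρ : ρ.PosSemidef) :
    (idKrausApply K ρ).PosSemidef :=
  Matrix.posSemidef_sum _ fun _ _ => hρ.mul_mul_conjTranspose_same _

theorem trace_idKrausApply {a b c m : ℕ} {K : Fin m → Matrix (Fin c) (Fin b) ℂ}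
    (hK : ∑ k, (K k)ᴴ * K k = 1) (ρ : Matrix (Fin a × Fin b) (Fin a × Fin b) ℂ) :
    (idKrausApply K ρ).trace = ρ.trace := by
  have h (k : Fin m) : (((1 : Matrix (Fin a) (Fin a) ℂ) ⊗ₖ K k) * ρ *
      ((1 : Matrix (Fin a) (Fin a) ℂ) ⊗ₖ K k)ᴴ).trace =
      (((1 : Matrix (Fin a) (Fin a) ℂ) ⊗ₖ ((K k)ᴴ * K k)) * ρ).trace := by
    rw [Matrix.trace_mul_comm, ← Matrix.mul_assoc, Matrix.conjTranspose_kronecker,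
      ← Matrix.mul_kronecker_mul, Matrix.conjTranspose_one, Matrix.one_mul]
  have hsum : ∑ k, (1 : Matrix (Fin a) (Fin a) ℂ) ⊗ₖ ((K k)ᴴ * K k) = 1 := by
    rw [← Matrix.one_kronecker_one, ← hK]
    ext i j
    simp [Matrix.sum_apply, Matrix.kroneckerMap_apply, Finset.mul_sum]
  rw [idKrausApply, Matrix.trace_sum, Finset.sum_congr rfl fun k _ => h k, ← Matrix.trace_sum,
    ← Finset.sum_mul, hsum, Matrix.one_mul]


/-- if every encoded state `ωⁱ = (id ⊗ Dᵢ)(ρ)` of an `N`-message dense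
coding protocol over a `|C|`-dimensional channel satisfies the reduction criterion
`ωⁱ ≤ ρ_A ⊗ I_C`, then every measurement `{M_y}` yields mutual information
`I(X;Y) ≤ log₂ |C|` for the joint distribution `p(x,y) = (1/N) tr(M_y ω^x)`. -/
theorem stmt_18 {a b c N m : ℕ} (hN : 0 < N) (hc : 0 < c)
    (ρ : Matrix (Fin a × Fin b) (Fin a × Fin b) ℂ)
    (hρ : ρ.PosSemidef) (hρtr : ρ.trace = 1)
    (K : Fin N → Fin m → Matrix (Fin c) (Fin b) ℂ)
    (hK : ∀ i, ∑ k, (K i k)ᴴ * K i k = 1)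
    (hred : ∀ i,
      ((ptraceB ρ) ⊗ₖ (1 : Matrix (Fin c) (Fin c) ℂ) - idKrausApply (K i) ρ).PosSemidef)
    {Y : Type*} [Fintype Y]
    (M : Y → Matrix (Fin a × Fin c) (Fin a × Fin c) ℂ)
    (hM : ∀ y, (M y).PosSemidef) (hMsum : ∑ y, M y = 1) :
    mutInfo (fun (x : Fin N) (y : Y) =>
        ((1 / (N : ℂ)) * Matrix.trace (M y * idKrausApply (K x) ρ)).re) ≤
      Real.logb 2 c := by
  set R := ptraceB ρ ⊗ₖ (1 : Matrix (Fin c) (Fin c) ℂ) with hR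
  have hNpos : (0 : ℝ) < N := Nat.cast_pos.mpr hN
  have hreal (x : Fin N) (y : Y) : ((1 / (N : ℂ)) * (M y * idKrausApply (K x) ρ).trace).re =
      1 / (N : ℝ) * (M y * idKrausApply (K x) ρ).trace.re := by
    rw [← Complex.re_ofReal_mul]
    push_cast
    rfl
  simp only [hreal]
  have htrace (A : Matrix (Fin a × Fin c) (Fin a × Fin c) ℂ) :
      ∑ y, (M y * A).trace.re = A.trace.re := by
    rw [← Complex.re_sum, ← Matrix.trace_sum, ← Finset.sum_mul, hMsum, Matrix.one_mul]
  have hrow (x : Fin N) : ∑ y, 1 / (N : ℝ) * (M y * idKrausApply (K x) ρ).trace.re = 1 / N := by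
    rw [← Finset.mul_sum, htrace, trace_idKrausApply (hK x), hρtr, Complex.one_re, mul_one]
  have hq (x : Fin N) (y : Y) : 0 ≤ (M y * idKrausApply (K x) ρ).trace.re :=
    (hM y).re_trace_mul_nonneg (idKrausApply_posSemidef (K x) hρ)
  have hle (x : Fin N) (y : Y) : (M y * idKrausApply (K x) ρ).trace.re ≤ (M y * R).trace.re := by
    have h := (hM y).re_trace_mul_nonneg (hred x)
    rwa [Matrix.mul_sub, Matrix.trace_sub, Complex.sub_re, sub_nonneg] at h
  refine mutInfo_le_logb_of_le_mul _ (fun y => (M y * R).trace.re) (Nat.cast_pos.mpr hc)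
    (fun x y => mul_nonneg (by positivity) (hq x y)) ?_
    (fun y => (hq ⟨0, hN⟩ y).trans (hle ⟨0, hN⟩ y)) ?_ fun x y => ?_
  · simp only [hrow]
    simp [hNpos.ne']
  · rw [htrace, hR, Matrix.trace_kronecker, trace_ptraceB, hρtr, one_mul, Matrix.trace_one]
    simp
  · rw [hrow]
    exact mul_le_mul_of_nonneg_left (hle x y) (by positivity)
end
end
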